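/- arXiv:1712.00613 — 2 statements merged into one kernel-verified Lean document; each statement's English description precedes it below -/
import Mathlib

section
/- For every natural number d ≥ 2, the counts in the complete bipartite graph K_{2,d} satisfy 3 · θ_{2,2,2}(K_{2,d}) = (d - 2) · C_4(K_{2,d}); equivalently, the ratio θ_{2,2,2}/C_4 equals (d-2)/3. -/
open SimpleGraph

/-- The number of subgraphs of `G` whose coercion to a simple graph is
isomorphic to `H`. -/
noncomputable def subgraphCount {V : Type*} {W : Type*} (G : SimpleGraph V)
    (H : SimpleGraph W) : ℕ :=
  Nat.card {A : G.Subgraph // Nonempty (A.coe ≃g H)}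

lemma subgraphCount_congr_right {V W W' : Type*} (G : SimpleGraph V) {H : SimpleGraph W}
    {H' : SimpleGraph W'} (e : H ≃g H') : subgraphCount G H = subgraphCount G H' :=
  Nat.card_congr <| Equiv.subtypeEquivRight fun _ =>
    ⟨fun ⟨f⟩ => ⟨f.trans e⟩, fun ⟨f⟩ => ⟨f.trans e.symm⟩⟩

/-- The 4-cycle is the complete bipartite graph `K_{2,2}`. -/
def cycleGraphFourIso : cycleGraph 4 ≃g completeBipartiteGraph (Fin 2) (Fin 2) where
  toFun := ![.inl 0, .inr 0, .inl 1, .inr 1]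
  invFun := Sum.elim ![0, 2] ![1, 3]
  left_inv := by decide
  right_inv := by decide
  map_rel_iff' := by
    intro a b
    fin_cases a <;> fin_cases b <;> simp [cycleGraph, completeBipartiteGraph] <;> decide

/-- The subgraph of `K_{m,n}` spanned by the whole left part and a subset `s` of the right part. -/
def rightSubgraph {α β : Type*} (s : Finset β) : (completeBipartiteGraph α β).Subgraph :=
  (⊤ : (completeBipartiteGraph α β).Subgraph).induce (Set.range Sum.inl ∪ Sum.inr '' (s : Set β))

lemma inr_mem_rightSubgraph_verts {α β : Type*} {s : Finset β} {b : β} :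
    Sum.inr b ∈ (rightSubgraph (α := α) s).verts ↔ b ∈ s := by
  simp [rightSubgraph]

lemma rightSubgraph_injective {α β : Type*} :
    Function.Injective (rightSubgraph (α := α) (β := β)) := fun s t h => by
  ext b
  rw [← inr_mem_rightSubgraph_verts (α := α), h, inr_mem_rightSubgraph_verts]

lemma nonempty_rightSubgraph_iso {α β : Type*} {s : Finset β} {k : ℕ} (hs : s.card = k) :
    Nonempty ((rightSubgraph (α := α) s).coe ≃g completeBipartiteGraph α (Fin k)) := by
  let e := s.equivFinOfCardEq hs
  let f : α ⊕ Fin k → (rightSubgraph (α := α) s).verts :=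
    Sum.elim (fun a => ⟨.inl a, by simp [rightSubgraph]⟩)
      (fun i => ⟨.inr (e.symm i), inr_mem_rightSubgraph_verts.2 (e.symm i).2⟩)
  have hf : Function.Bijective f := by
    constructor
    · rintro (a | i) (b | j) h <;> simp_all [f]
    · rintro ⟨a | b, h⟩
      · exact ⟨.inl a, rfl⟩
      · exact ⟨.inr (e ⟨b, inr_mem_rightSubgraph_verts.1 h⟩), by simp [f]⟩
  refine ⟨(RelIso.mk (Equiv.ofBijective f hf) ?_).symm⟩
  intro x y
  change (rightSubgraph s).Adj (f x : α ⊕ β) (f y : α ⊕ β) ↔ _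
  rcases x with a | i <;> rcases y with b | j <;> simp [f, rightSubgraph]

/-- Nonadjacent vertices of `K_{m,n}` have a common neighbour. -/
lemma completeBipartiteGraph_adj_or_exists_common {α β : Type*} [Nonempty α] [Nonempty β]
    (x y : α ⊕ β) : (completeBipartiteGraph α β).Adj x y ∨
      ∃ z, (completeBipartiteGraph α β).Adj x z ∧ (completeBipartiteGraph α β).Adj y z := by
  rcases x with a | b <;> rcases y with c | d <;> simp

lemma completeBipartiteGraph_exists_two_neighbors {α β : Type*} [Nontrivial α] [Nontrivial β]
    (x : α ⊕ β) : ∃ y z, y ≠ z ∧ (completeBipartiteGraph α β).Adj x y ∧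
      (completeBipartiteGraph α β).Adj x z := by
  rcases x with a | b
  · obtain ⟨y, z, h⟩ := exists_pair_ne β
    exact ⟨.inr y, .inr z, by simpa using h, by simp, by simp⟩
  · obtain ⟨y, z, h⟩ := exists_pair_ne α
    exact ⟨.inl y, .inl z, by simpa using h, by simp, by simp⟩

lemma exists_eq_rightSubgraph {β : Type*} [Finite β] {k : ℕ} (hk : 2 ≤ k)
    {A : (completeBipartiteGraph (Fin 2) β).Subgraph}
    (e : A.coe ≃g completeBipartiteGraph (Fin 2) (Fin k)) :
    ∃ s : Finset β, s.card = k ∧ rightSubgraph s = A := by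
  have : Nontrivial (Fin k) := Fin.nontrivial_iff_two_le.2 hk
  have two (x : A.verts) : ∃ y z : A.verts, y ≠ z ∧ A.Adj x y ∧ A.Adj x z := by
    obtain ⟨y, z, hne, hy, hz⟩ := completeBipartiteGraph_exists_two_neighbors (e x)
    obtain ⟨y, rfl⟩ := e.surjective y
    obtain ⟨z, rfl⟩ := e.surjective z
    exact ⟨y, z, fun h => hne (congrArg e h), e.map_adj_iff.1 hy, e.map_adj_iff.1 hz⟩
  have common (x y : A.verts) : A.Adj x y ∨ ∃ z : A.verts, A.Adj x z ∧ A.Adj y z := by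
    rcases completeBipartiteGraph_adj_or_exists_common (e x) (e y) with h | ⟨z, hx, hy⟩
    · exact .inl (e.map_adj_iff.1 h)
    · obtain ⟨z, rfl⟩ := e.surjective z
      exact .inr ⟨z, e.map_adj_iff.1 hx, e.map_adj_iff.1 hy⟩
  obtain ⟨b, hb⟩ : ∃ b, Sum.inr b ∈ A.verts := by
    obtain ⟨⟨x, hx⟩⟩ : Nonempty A.verts := ⟨e.symm (.inl 0)⟩
    obtain ⟨⟨y, hy⟩, -, -, h, -⟩ := two ⟨x, hx⟩
    have hG := A.adj_sub h
    rcases x with x | x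
    · rcases y with y | y
      · simp at hG
      · exact ⟨y, hy⟩
    · exact ⟨x, hx⟩
  have hl (i : Fin 2) : Sum.inl i ∈ A.verts := by
    obtain ⟨⟨y, hy⟩, ⟨z, hz⟩, hne, hay, haz⟩ := two ⟨_, hb⟩
    have hGy := A.adj_sub hay
    have hGz := A.adj_sub haz
    rcases y with y | y <;> rcases z with z | z <;> simp at hGy hGz
    have hne : y ≠ z := by simpa using hne
    obtain rfl | rfl : i = y ∨ i = z := by omega
    · exact hy
    · exact hz
  have hA {i b} (h : Sum.inr b ∈ A.verts) : A.Adj (.inl i) (.inr b) := by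
    rcases common ⟨_, hl i⟩ ⟨_, h⟩ with h | ⟨⟨z, _⟩, h₁, h₂⟩
    · exact h
    · have h₁ := A.adj_sub h₁
      have h₂ := A.adj_sub h₂
      rcases z with z | z <;> simp at h₁ h₂
  let s : Finset β := (Set.toFinite {b | Sum.inr b ∈ A.verts}).toFinset
  have hs : rightSubgraph s = A := by
    ext x y
    · rcases x with i | b
      · simp [rightSubgraph, hl]
      · simp [rightSubgraph, s]
    · rcases x with i | b <;> rcases y with j | c
      · simpa [rightSubgraph] using fun h => by simpa using A.adj_sub h
      · simpa [rightSubgraph, s] using ⟨hA, fun h => A.edge_vert h.symm⟩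
      · simpa [rightSubgraph, s] using ⟨fun h => (hA h).symm, fun h => A.edge_vert h⟩
      · simpa [rightSubgraph] using fun h => by simpa using A.adj_sub h
  refine ⟨s, ?_, hs⟩
  obtain ⟨f⟩ := nonempty_rightSubgraph_iso (α := Fin 2) (s := s) rfl
  rw [hs] at f
  simpa using Nat.card_congr (f.symm.trans e).toEquiv

lemma subgraphCount_completeBipartiteGraph_two (d : ℕ) {k : ℕ} (hk : 2 ≤ k) :
    subgraphCount (completeBipartiteGraph (Fin 2) (Fin d))
      (completeBipartiteGraph (Fin 2) (Fin k)) = d.choose k := by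
  let f : {s : Finset (Fin d) // s.card = k} →
      {A : (completeBipartiteGraph (Fin 2) (Fin d)).Subgraph //
        Nonempty (A.coe ≃g completeBipartiteGraph (Fin 2) (Fin k))} :=
    fun s => ⟨rightSubgraph s.1, nonempty_rightSubgraph_iso s.2⟩
  have hf : Function.Bijective f := by
    constructor
    · exact fun s t h => Subtype.ext (rightSubgraph_injective (congrArg Subtype.val h))
    · rintro ⟨A, ⟨e⟩⟩
      obtain ⟨s, hs, rfl⟩ := exists_eq_rightSubgraph hk e
      exact ⟨⟨s, hs⟩, rfl⟩
  rw [subgraphCount, ← Nat.card_eq_of_bijective f hf, Nat.card_eq_fintype_card,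
    Fintype.card_finset_len, Fintype.card_fin]

theorem theta222_C4_ratio_K2d (d : ℕ) (hd : 2 ≤ d) :
    3 * subgraphCount (completeBipartiteGraph (Fin 2) (Fin d))
          (completeBipartiteGraph (Fin 2) (Fin 3)) =
      (d - 2) * subgraphCount (completeBipartiteGraph (Fin 2) (Fin d))
          (cycleGraph 4) := by
  rw [subgraphCount_congr_right _ cycleGraphFourIso,
    subgraphCount_completeBipartiteGraph_two d (by norm_num),
    subgraphCount_completeBipartiteGraph_two d le_rfl, mul_comm 3, mul_comm (d - 2)]
  exact Nat.choose_succ_right_eq d 2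
end

section
/- For every rational number κ there exists a natural number d ≥ 5 such that in the complete bipartite graph K_{2,d} the number of subgraphs isomorphic to the 6-cycle is 0 and the number of subgraphs isomorphic to K_{2,3} exceeds κ times the number of subgraphs isomorphic to the 4-cycle, i.e., θ_{2,2,2}(K_{2,d}) > κ · C_4(K_{2,d}). -/
open SimpleGraph

/-- The subgraph of `K_{2,d}` induced by both left vertices and a set `S` of right vertices. -/
def inducedOnRight {d : ℕ} (S : Finset (Fin d)) :
    (completeBipartiteGraph (Fin 2) (Fin d)).Subgraph :=
  (⊤ : (completeBipartiteGraph (Fin 2) (Fin d)).Subgraph).induce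
    ((Finset.univ.disjSum S : Finset (Fin 2 ⊕ Fin d)) : Set (Fin 2 ⊕ Fin d))

theorem inducedOnRight_injective {d : ℕ} :
    Function.Injective (inducedOnRight : Finset (Fin d) → _) := by
  intro S T h
  have hv := congrArg Subgraph.verts h
  ext j
  have := Set.ext_iff.mp hv (Sum.inr j)
  simpa [inducedOnRight] using this

theorem nonempty_iso_inducedOnRight {d n : ℕ} (S : Finset (Fin d)) (hS : S.card = n) :
    Nonempty ((inducedOnRight S).coe ≃g completeBipartiteGraph (Fin 2) (Fin n)) := by
  let e := S.orderEmbOfFin hS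
  let f : Fin 2 ⊕ Fin n → (inducedOnRight S).verts := fun x =>
    ⟨Sum.map id e x, by
      rcases x with i | j
      · simp [inducedOnRight]
      · simp [inducedOnRight, e]⟩
  have hf : Function.Bijective f := by
    constructor
    · intro x y h
      exact (Function.injective_id.sumMap e.injective) (congrArg Subtype.val h)
    · rintro ⟨i | j, hx⟩
      · exact ⟨Sum.inl i, rfl⟩
      · have hj : j ∈ Set.range e := by
          rw [Finset.range_orderEmbOfFin]
          simpa [inducedOnRight] using hx
        obtain ⟨k, rfl⟩ := hj
        exact ⟨Sum.inr k, rfl⟩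
  refine ⟨(RelIso.mk (Equiv.ofBijective f hf) ?_).symm⟩
  intro x y
  change (inducedOnRight S).Adj (f x) (f y) ↔ _
  rcases x with i | i <;> rcases y with j | j <;> simp [f, inducedOnRight, e]

/-- A nonempty subgraph of `K_{2,d}` in which every vertex has two neighbours is induced by its
right vertices together with both left vertices. -/
theorem exists_eq_inducedOnRight {d : ℕ} {W : Type*} [Nonempty W] {H : SimpleGraph W}
    (hH : ∀ v, ∃ a b, a ≠ b ∧ H.Adj v a ∧ H.Adj v b)
    (A : (completeBipartiteGraph (Fin 2) (Fin d)).Subgraph) (φ : A.coe ≃g H) :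
    ∃ S : Finset (Fin d), A = inducedOnRight S := by
  classical
  have hA : ∀ v ∈ A.verts, ∃ a b, a ≠ b ∧ A.Adj v a ∧ A.Adj v b := by
    intro v hv
    obtain ⟨a, b, hab, ha, hb⟩ := hH (φ ⟨v, hv⟩)
    refine ⟨φ.symm a, φ.symm b, ?_, ?_, ?_⟩
    · simpa [Subtype.coe_inj] using hab
    · simpa using φ.symm.map_adj_iff.mpr ha
    · simpa using φ.symm.map_adj_iff.mpr hb
  have hright : ∀ j, Sum.inr j ∈ A.verts → ∀ i, A.Adj (Sum.inr j) (Sum.inl i) := by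
    intro j hj i
    obtain ⟨a, b, hab, ha, hb⟩ := hA _ hj
    rcases a with a | a
    · rcases b with b | b
      · have : i = a ∨ i = b := by
          have : a ≠ b := fun h => hab (congrArg _ h)
          omega
        rcases this with rfl | rfl <;> assumption
      · simpa using hb.adj_sub
    · simpa using ha.adj_sub
  have hleft : ∀ i, Sum.inl i ∈ A.verts := by
    obtain ⟨j, hj⟩ : ∃ j, Sum.inr j ∈ A.verts := by
      obtain ⟨v, hv⟩ := φ.symm (Classical.arbitrary W)
      rcases v with i | j
      · obtain ⟨a, -, -, ha, -⟩ := hA _ hv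
        rcases a with a | a
        · simpa using ha.adj_sub
        · exact ⟨a, ha.snd_mem⟩
      · exact ⟨j, hv⟩
    exact fun i => (hright j hj i).snd_mem
  refine ⟨Finset.univ.filter fun j => Sum.inr j ∈ A.verts, ?_⟩
  ext x y
  · rcases x with i | j <;> simp [inducedOnRight, hleft]
  · rcases x with i | j <;> rcases y with k | l
    · simpa [inducedOnRight] using fun h : A.Adj _ _ => by simpa using h.adj_sub
    · simpa [inducedOnRight] using
        ⟨fun h : A.Adj _ _ => h.snd_mem, fun h => (hright l h i).symm⟩
    · simpa [inducedOnRight] using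
        ⟨fun h : A.Adj _ _ => h.fst_mem, fun h => hright j h k⟩
    · simpa [inducedOnRight] using fun h : A.Adj _ _ => by simpa using h.adj_sub

theorem card_eq_of_iso_inducedOnRight {d n : ℕ} {H : SimpleGraph (Fin n)} (S : Finset (Fin d))
    (φ : (inducedOnRight S).coe ≃g H) : 2 + S.card = n := by
  have h := Nat.card_congr φ.toEquiv
  have h' : Nat.card (inducedOnRight S).verts = 2 + S.card := by
    change Nat.card ((Finset.univ.disjSum S : Finset (Fin 2 ⊕ Fin d)) : Set (Fin 2 ⊕ Fin d)) = _
    simp [Finset.card_disjSum]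
  rw [h', Nat.card_fin] at h
  exact h

theorem subgraphCount_cycleGraph_four_le (d : ℕ) :
    subgraphCount (completeBipartiteGraph (Fin 2) (Fin d)) (cycleGraph 4) ≤ d.choose 2 := by
  have key (A : {A : (completeBipartiteGraph (Fin 2) (Fin d)).Subgraph //
      Nonempty (A.coe ≃g cycleGraph 4)}) :
      ∃ S : Finset (Fin d), S ∈ Finset.univ.powersetCard 2 ∧ A.1 = inducedOnRight S := by
    obtain ⟨A, ⟨φ⟩⟩ := A
    obtain ⟨S, rfl⟩ := exists_eq_inducedOnRight (by simp only [cycleGraph_adj]; decide) A φ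
    have := card_eq_of_iso_inducedOnRight S φ
    exact ⟨S, by simp only [Finset.mem_powersetCard_univ]; omega, rfl⟩
  choose g hg hgA using key
  have hinj : Function.Injective
      (fun A => (⟨g A, hg A⟩ : (Finset.univ : Finset (Fin d)).powersetCard 2)) := by
    intro A B h
    apply Subtype.ext
    rw [hgA A, hgA B, show g A = g B from congrArg Subtype.val h]
  simpa [subgraphCount] using Nat.card_le_card_of_injective _ hinj

theorem choose_le_subgraphCount_completeBipartiteGraph (d n : ℕ) :
    d.choose n ≤ subgraphCount (completeBipartiteGraph (Fin 2) (Fin d))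
      (completeBipartiteGraph (Fin 2) (Fin n)) := by
  let g : (Finset.univ : Finset (Fin d)).powersetCard n →
      {A : (completeBipartiteGraph (Fin 2) (Fin d)).Subgraph //
        Nonempty (A.coe ≃g completeBipartiteGraph (Fin 2) (Fin n))} := fun S =>
    ⟨inducedOnRight S.1, nonempty_iso_inducedOnRight S.1 (Finset.mem_powersetCard_univ.mp S.2)⟩
  have hg : Function.Injective g := fun S T h =>
    Subtype.ext (inducedOnRight_injective (congrArg Subtype.val h))
  simpa [subgraphCount] using Nat.card_le_card_of_injective g hg

theorem subgraphCount_cycleGraph_six (d : ℕ) :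
    subgraphCount (completeBipartiteGraph (Fin 2) (Fin d)) (cycleGraph 6) = 0 := by
  have : IsEmpty {A : (completeBipartiteGraph (Fin 2) (Fin d)).Subgraph //
      Nonempty (A.coe ≃g cycleGraph 6)} := by
    refine ⟨fun ⟨A, ⟨φ⟩⟩ => ?_⟩
    obtain ⟨S, rfl⟩ := exists_eq_inducedOnRight (by simp only [cycleGraph_adj]; decide) A φ
    have hS : S.card = 4 := by have := card_eq_of_iso_inducedOnRight S φ; omega
    obtain ⟨ψ⟩ := nonempty_iso_inducedOnRight S hS
    let χ := ψ.symm.trans φ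
    have h (j : Fin 4) : (cycleGraph 6).Adj (χ (Sum.inl 0)) (χ (Sum.inr j)) :=
      χ.map_rel_iff.mpr (by simp)
    have hle : (Finset.univ : Finset (Fin 4)).card ≤
        ((cycleGraph 6).neighborFinset (χ (Sum.inl 0))).card :=
      Finset.card_le_card_of_injOn (fun j => χ (Sum.inr j)) (fun j _ => by simpa using h j)
        (fun i _ j _ hij => Sum.inr_injective (χ.injective hij))
    have hdeg := cycleGraph_degree_three_le (n := 3) (v := χ (Sum.inl 0))
    rw [card_neighborFinset_eq_degree, hdeg] at hle
    simp at hle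
  exact Nat.card_of_isEmpty

theorem exists_K2d_with_large_theta_over_C4 (κ : ℚ) :
    ∃ d : ℕ, 5 ≤ d ∧
      subgraphCount (completeBipartiteGraph (Fin 2) (Fin d)) (cycleGraph 6) = 0 ∧
      (subgraphCount (completeBipartiteGraph (Fin 2) (Fin d))
          (completeBipartiteGraph (Fin 2) (Fin 3)) : ℚ) >
        κ * (subgraphCount (completeBipartiteGraph (Fin 2) (Fin d))
          (cycleGraph 4) : ℚ) := by
  have hκ : κ ≤ ⌈κ⌉₊ := Nat.le_ceil κ
  set K := ⌈κ⌉₊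
  refine ⟨3 * K + 5, by omega, subgraphCount_cycleGraph_six _, ?_⟩
  have h4 := subgraphCount_cycleGraph_four_le (3 * K + 5)
  have h3 := choose_le_subgraphCount_completeBipartiteGraph (3 * K + 5) 3
  have hlt : K * (3 * K + 5).choose 2 < (3 * K + 5).choose 3 := by
    have h := Nat.choose_succ_right_eq (3 * K + 5) 2
    have hpos : 0 < (3 * K + 5).choose 2 := Nat.choose_pos (by omega)
    rw [show 3 * K + 5 - 2 = 3 * K + 3 by omega] at h
    norm_num at h
    nlinarith
  refine lt_of_le_of_lt (mul_le_mul_of_nonneg_right hκ (Nat.cast_nonneg _)) ?_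
  exact_mod_cast (Nat.mul_le_mul_left K h4).trans_lt (hlt.trans_le h3)
end
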